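/- For every ν ∈ [-1/2, 1), the supremum of F_ν(θ₁, θ₂, θ₃) over all triples of positive reals (θ₁, θ₂, θ₃) with θᵢ ≠ θⱼ for some i, j equals C_ν := sup_{x>0} (3·ln(1 + x/3) − ln(1 + (1+2ν)x/3) − 2·ln(1 + (1−ν)x/3)) / (3·ln(1 + x/3) − ln(1 + x)). -/

import Mathlib

/-- The functional `F_ν` of the ES-BGK entropy comparison, expressed in terms of the
eigenvalues `θ₁, θ₂, θ₃` of the stress tensor. -/
noncomputable def Fnu (ν θ₁ θ₂ θ₃ : ℝ) : ℝ :=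
  (3 * Real.log ((θ₁+θ₂+θ₃)/3)
    - Real.log (((1-ν) * ((θ₁+θ₂+θ₃)/3) + ν*θ₁) * ((1-ν) * ((θ₁+θ₂+θ₃)/3) + ν*θ₂)
        * ((1-ν) * ((θ₁+θ₂+θ₃)/3) + ν*θ₃)))
  / (3 * Real.log ((θ₁+θ₂+θ₃)/3) - Real.log (θ₁*θ₂*θ₃))

/-- The quotient `F_ν` for normalised eigenvalues `1 + 2s, 1 - s, 1 - s`, which have mean `1`. -/
noncomputable def axialQuotient (ν s : ℝ) : ℝ :=
  Real.log (1 - 3*ν^2*s^2 + 2*ν^3*s^3) / Real.log (1 - 3*s^2 + 2*s^3)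

theorem axial_det_pos {ν s : ℝ} (hν1 : -1/2 ≤ ν) (hν2 : ν ≤ 1) (hs0 : 0 < s) (hs1 : s < 1) :
    0 < 1 - 3*ν^2*s^2 + 2*ν^3*s^3 := by
  have h1 : 0 < 1 + 2*ν*s := by nlinarith
  have h2 : 0 < 1 - ν*s := by nlinarith
  have : 1 - 3*ν^2*s^2 + 2*ν^3*s^3 = (1 + 2*ν*s) * (1 - ν*s)^2 := by ring
  rw [this]
  positivity

theorem axial_log_neg {s : ℝ} (hs0 : 0 < s) (hs1 : s < 1) :
    Real.log (1 - 3*s^2 + 2*s^3) < 0 := by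
  have h := axial_det_pos (ν := 1) (by norm_num) le_rfl hs0 hs1
  have h2 : 0 < s^2 := by positivity
  apply Real.log_neg <;> nlinarith

theorem quotient_eq_axialQuotient {ν x : ℝ} (hν1 : -1/2 ≤ ν) (hν2 : ν < 1) (hx : 0 < x) :
    (3 * Real.log (1 + x/3) - Real.log (1 + (1+2*ν)*x/3) - 2 * Real.log (1 + (1-ν)*x/3))
      / (3 * Real.log (1 + x/3) - Real.log (1 + x)) = axialQuotient ν (x / (3 + x)) := by
  have h0 : 0 < 1 + x/3 := by positivity
  have h1 : 0 < 1 + (1+2*ν)*x/3 := by nlinarith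
  have h2 : 0 < 1 + (1-ν)*x/3 := by nlinarith
  have h3 : 0 < 1 + x := by positivity
  have e1 : 1 - 3*ν^2*(x/(3+x))^2 + 2*ν^3*(x/(3+x))^3
      = (1 + (1+2*ν)*x/3) * (1 + (1-ν)*x/3)^2 / (1 + x/3)^3 := by
    field_simp
    ring
  have e2 : 1 - 3*(x/(3+x))^2 + 2*(x/(3+x))^3 = (1 + x) / (1 + x/3)^3 := by
    field_simp
    ring
  rw [axialQuotient, e1, e2, Real.log_div (by positivity) (by positivity),
    Real.log_div (by positivity) (by positivity), Real.log_mul (by positivity) (by positivity),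
    Real.log_pow, Real.log_pow, ← neg_div_neg_eq]
  push_cast
  congr 1 <;> ring

theorem axialQuotient_le_one {ν s : ℝ} (hν1 : -1/2 ≤ ν) (hν2 : ν < 1) (hs0 : 0 < s)
    (hs1 : s < 1) : axialQuotient ν s ≤ 1 := by
  rw [axialQuotient, div_le_one_of_neg (axial_log_neg hs0 hs1)]
  have h := axial_det_pos (ν := 1) (by norm_num) le_rfl hs0 hs1
  apply Real.log_le_log (by linarith)
  have h3 : 0 ≤ 3*(1+ν) - 2*s*(1+ν+ν^2) := by
    nlinarith [mul_nonneg (by linarith : 0 ≤ 2*ν+1) (by linarith : 0 ≤ 1-ν),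
      mul_nonneg (by linarith : 0 ≤ 1 - s) (by nlinarith [sq_nonneg (ν+1/2)] : 0 ≤ 1+ν+ν^2)]
  have h4 : 0 ≤ (1-ν)*s^2*(3*(1+ν) - 2*s*(1+ν+ν^2)) :=
    mul_nonneg (mul_nonneg (by linarith) (sq_nonneg s)) h3
  nlinarith

/-- Any upper bound of the axial quotients is at least their limit `ν²` as `s → 0`. -/
theorem sq_le_of_axialQuotient_le {ν C : ℝ} (hν1 : -1/2 ≤ ν) (hν2 : ν < 1)
    (hC : ∀ s, 0 < s → s < 1 → axialQuotient ν s ≤ C) : ν^2 ≤ C := by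
  have key : ∀ s, 0 < s → s < 1 →
      (3*ν^2 - 2*ν^3*s) * (1 - 3*s^2 + 2*s^3) ≤ C * (3 - 2*s) := by
    intro s hs0 hs1
    have hA : 0 < 1 - 3*s^2 + 2*s^3 := by
      have := axial_det_pos (ν := 1) (by norm_num) le_rfl hs0 hs1
      linarith
    have hB := axial_det_pos hν1 hν2.le hs0 hs1
    have hB1 : 1 - 3*ν^2*s^2 + 2*ν^3*s^3 ≤ 1 := by
      have h1 : 0 ≤ 3 - 2*(ν*s) := by nlinarith
      nlinarith [mul_nonneg (sq_nonneg (ν*s)) h1]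
    have hneg := axial_log_neg hs0 hs1
    have hlogB : Real.log (1 - 3*ν^2*s^2 + 2*ν^3*s^3) ≤ -(s^2 * (3*ν^2 - 2*ν^3*s)) := by
      have := Real.log_le_sub_one_of_pos hB
      linarith
    have hlogA := Real.one_sub_inv_le_log_of_pos hA
    have hC0 : 0 ≤ C := (div_nonneg_of_nonpos (Real.log_nonpos hB.le hB1) hneg.le).trans
      (hC s hs0 hs1)
    have h := hC s hs0 hs1
    rw [axialQuotient, div_le_iff_of_neg hneg] at h
    have h1 : C * (1 - (1 - 3*s^2 + 2*s^3)⁻¹) ≤ -(s^2 * (3*ν^2 - 2*ν^3*s)) :=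
      (mul_le_mul_of_nonneg_left hlogA hC0).trans (h.trans hlogB)
    have h2 := mul_le_mul_of_nonneg_right h1 hA.le
    have h3 : C * (1 - (1 - 3*s^2 + 2*s^3)⁻¹) * (1 - 3*s^2 + 2*s^3)
        = -(s^2 * (C * (3 - 2*s))) := by
      rw [mul_assoc, sub_mul, inv_mul_cancel₀ hA.ne']
      ring
    rw [h3] at h2
    have hs2 : 0 < s^2 := by positivity
    refine le_of_mul_le_mul_left ?_ hs2
    linarith
  have hmem : ∀ᶠ s in nhdsWithin (0:ℝ) (Set.Ioi 0),
      (3*ν^2 - 2*ν^3*s) * (1 - 3*s^2 + 2*s^3) ≤ C * (3 - 2*s) := by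
    filter_upwards [Ioo_mem_nhdsGT (zero_lt_one (α := ℝ))] with s hs using key s hs.1 hs.2
  have hl : Filter.Tendsto (fun s : ℝ => (3*ν^2 - 2*ν^3*s) * (1 - 3*s^2 + 2*s^3))
      (nhdsWithin 0 (Set.Ioi 0)) (nhds ((3*ν^2 - 2*ν^3*0) * (1 - 3*0^2 + 2*0^3))) :=
    (Continuous.tendsto (by fun_prop) 0).mono_left nhdsWithin_le_nhds
  have hr : Filter.Tendsto (fun s : ℝ => C * (3 - 2*s))
      (nhdsWithin 0 (Set.Ioi 0)) (nhds (C * (3 - 2*0))) :=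
    (Continuous.tendsto (by fun_prop) 0).mono_left nhdsWithin_le_nhds
  have := le_of_tendsto_of_tendsto hl hr hmem
  linarith

/-- With the second symmetric function fixed to `-3s²`, the bound at the extremal value `2s³` of
the third symmetric function propagates to every smaller value. -/
theorem mul_log_le_log_of_le {ν C s q : ℝ} (hν1 : -1/2 ≤ ν) (hν2 : ν < 1) (hs0 : 0 < s)
    (hs1 : s < 1) (hC : ν^2 ≤ C) (hsC : axialQuotient ν s ≤ C) (hq : q ≤ 2*s^3)
    (hA : 0 < 1 - 3*s^2 + q) (hB : 0 < 1 - 3*ν^2*s^2 + ν^3*q) :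
    C * Real.log (1 - 3*s^2 + q) ≤ Real.log (1 - 3*ν^2*s^2 + ν^3*q) := by
  have hB0 := axial_det_pos hν1 hν2.le hs0 hs1
  have hApos : ∀ t ∈ Set.Icc q (2*s^3), 0 < 1 - 3*s^2 + t := fun t ht => by linarith [ht.1]
  have hBpos : ∀ t ∈ Set.Icc q (2*s^3), 0 < 1 - 3*ν^2*s^2 + ν^3*t := by
    intro t ht
    rcases le_total 0 (ν^3) with h | h
    · linarith [mul_le_mul_of_nonneg_left ht.1 h]
    · linarith [mul_le_mul_of_nonpos_left ht.2 h]
  have hd : ∀ t ∈ Set.Icc q (2*s^3), HasDerivAt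
      (fun t => Real.log (1 - 3*ν^2*s^2 + ν^3*t) - C * Real.log (1 - 3*s^2 + t))
      (ν^3 / (1 - 3*ν^2*s^2 + ν^3*t) - C * (1 / (1 - 3*s^2 + t))) t := by
    intro t ht
    have h1 : HasDerivAt (fun t => 1 - 3*ν^2*s^2 + ν^3*t) (ν^3) t := by
      simpa using ((hasDerivAt_id t).const_mul (ν^3)).const_add (1 - 3*ν^2*s^2)
    have h2 : HasDerivAt (fun t => 1 - 3*s^2 + t) 1 t :=
      (hasDerivAt_id t).const_add (1 - 3*s^2)
    exact (h1.log (hBpos t ht).ne').sub ((h2.log (hApos t ht).ne').const_mul C)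
  have hanti : AntitoneOn
      (fun t => Real.log (1 - 3*ν^2*s^2 + ν^3*t) - C * Real.log (1 - 3*s^2 + t))
      (Set.Icc q (2*s^3)) := by
    refine antitoneOn_of_deriv_nonpos (convex_Icc _ _)
      (fun t ht => (hd t ht).continuousAt.continuousWithinAt)
      (fun t ht => (hd t (interior_subset ht)).differentiableAt.differentiableWithinAt) ?_
    intro t ht
    replace ht := interior_subset ht
    have hAt := hApos t ht
    have hBt := hBpos t ht
    rw [(hd t ht).deriv, sub_nonpos, mul_one_div, div_le_div_iff₀ hBt hAt]
    have hAB : ν * (1 - 3*s^2 + t) ≤ 1 - 3*ν^2*s^2 + ν^3*t := by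
      rcases le_total ν 0 with h | h
      · nlinarith [mul_nonneg (neg_nonneg.2 h) hAt.le]
      · have h5 : 0 ≤ 1 + 3*ν*s^2 - ν*(1+ν)*t := by
          have h6 : ν*(1+ν)*t ≤ ν*(1+ν)*(2*s^3) :=
            mul_le_mul_of_nonneg_left ht.2 (by positivity)
          have h7 : ν*(1+ν)*(2*s^3) ≤ ν*2*(2*s^3) := by gcongr; linarith
          have h8 : s^3 ≤ s^2 := by nlinarith [sq_nonneg s]
          have h9 : s^2 ≤ 1 := by nlinarith
          have h10 : ν*s^3 ≤ ν*s^2 := mul_le_mul_of_nonneg_left h8 h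
          have h11 : ν*s^2 ≤ 1 := by nlinarith
          linarith
        nlinarith [mul_nonneg (sub_nonneg.2 hν2.le) h5]
    calc ν^3 * (1 - 3*s^2 + t) = ν^2 * (ν * (1 - 3*s^2 + t)) := by ring
      _ ≤ ν^2 * (1 - 3*ν^2*s^2 + ν^3*t) := mul_le_mul_of_nonneg_left hAB (sq_nonneg ν)
      _ ≤ C * (1 - 3*ν^2*s^2 + ν^3*t) := mul_le_mul_of_nonneg_right hC hBt.le
  have h := hanti (Set.left_mem_Icc.2 hq) (Set.right_mem_Icc.2 hq) hq
  rw [axialQuotient, div_le_iff_of_neg (axial_log_neg hs0 hs1)] at hsC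
  have e : 1 - 3*ν^2*s^2 + ν^3*(2*s^3) = 1 - 3*ν^2*s^2 + 2*ν^3*s^3 := by ring
  simp only [e] at h
  linarith

theorem Fnu_eq_of_mean {ν m a b c : ℝ} (hm : 0 < m) (habc : a + b + c = 0)
    (hA : 0 < (1+a)*(1+b)*(1+c)) (hB : 0 < (1+ν*a)*(1+ν*b)*(1+ν*c)) :
    Fnu ν (m*(1+a)) (m*(1+b)) (m*(1+c))
      = Real.log ((1+ν*a)*(1+ν*b)*(1+ν*c)) / Real.log ((1+a)*(1+b)*(1+c)) := by
  have e0 : (m*(1+a) + m*(1+b) + m*(1+c)) / 3 = m := by linear_combination m/3*habc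
  have e1 : ((1-ν)*m + ν*(m*(1+a))) * ((1-ν)*m + ν*(m*(1+b))) * ((1-ν)*m + ν*(m*(1+c)))
      = m^3 * ((1+ν*a)*(1+ν*b)*(1+ν*c)) := by ring
  have e2 : m*(1+a) * (m*(1+b)) * (m*(1+c)) = m^3 * ((1+a)*(1+b)*(1+c)) := by ring
  rw [Fnu, e0, e1, e2, Real.log_mul (by positivity) hB.ne', Real.log_mul (by positivity) hA.ne',
    Real.log_pow, ← neg_div_neg_eq]
  push_cast
  congr 1 <;> ring

theorem Fnu_axial {ν x : ℝ} (hν1 : -1/2 ≤ ν) (hν2 : ν < 1) (hx : 0 < x) :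
    Fnu ν (1+x) 1 1 = axialQuotient ν (x / (3 + x)) := by
  rw [← quotient_eq_axialQuotient hν1 hν2 hx, Fnu]
  have h1 : 0 < 1 + (1+2*ν)*x/3 := by nlinarith
  have h2 : 0 < 1 + (1-ν)*x/3 := by nlinarith
  have e0 : (1 + x + 1 + 1) / 3 = 1 + x/3 := by ring
  have e1 : ((1-ν)*(1+x/3) + ν*(1+x)) * ((1-ν)*(1+x/3) + ν*1) * ((1-ν)*(1+x/3) + ν*1)
      = (1 + (1+2*ν)*x/3) * (1 + (1-ν)*x/3)^2 := by ring
  rw [e0, e1, Real.log_mul (by positivity) (by positivity), Real.log_pow]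
  push_cast
  simp only [mul_one, sub_sub]

theorem Fnu_le_of_axialQuotient_le {ν C θ₁ θ₂ θ₃ : ℝ} (hν1 : -1/2 ≤ ν) (hν2 : ν < 1)
    (hC : ∀ s, 0 < s → s < 1 → axialQuotient ν s ≤ C)
    (h1 : 0 < θ₁) (h2 : 0 < θ₂) (h3 : 0 < θ₃) (hne : ¬(θ₁ = θ₂ ∧ θ₂ = θ₃)) :
    Fnu ν θ₁ θ₂ θ₃ ≤ C := by
  obtain ⟨m, hm⟩ : ∃ m, m = (θ₁ + θ₂ + θ₃) / 3 := ⟨_, rfl⟩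
  have hm0 : 0 < m := by rw [hm]; positivity
  obtain ⟨a, ha⟩ : ∃ a, a = θ₁ / m - 1 := ⟨_, rfl⟩
  obtain ⟨b, hb⟩ : ∃ b, b = θ₂ / m - 1 := ⟨_, rfl⟩
  obtain ⟨c, hc⟩ : ∃ c, c = θ₃ / m - 1 := ⟨_, rfl⟩
  have t1 : θ₁ = m*(1+a) := by rw [ha]; field_simp; ring
  have t2 : θ₂ = m*(1+b) := by rw [hb]; field_simp; ring
  have t3 : θ₃ = m*(1+c) := by rw [hc]; field_simp; ring
  have ha1 : 0 < 1 + a := by have := div_pos h1 hm0; linarith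
  have hb1 : 0 < 1 + b := by have := div_pos h2 hm0; linarith
  have hc1 : 0 < 1 + c := by have := div_pos h3 hm0; linarith
  have habc : a + b + c = 0 := by
    have : m * (a + b + c) = 0 := by linear_combination -t1 - t2 - t3 - 3*hm
    exact (mul_eq_zero.1 this).resolve_left hm0.ne'
  have hpos : ∀ u, 0 < 1 + u → u < 2 → 0 < 1 + ν*u := by
    intro u hu hu2
    rcases le_total 0 u with h | h <;> nlinarith
  have hB : 0 < (1+ν*a)*(1+ν*b)*(1+ν*c) :=
    mul_pos (mul_pos (hpos a ha1 (by linarith)) (hpos b hb1 (by linarith)))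
      (hpos c hc1 (by linarith))
  have hA : 0 < (1+a)*(1+b)*(1+c) := by positivity
  have hsq : 0 < a^2 + b^2 + c^2 := by
    by_contra hcon
    have ha0 : a = 0 := by nlinarith [sq_nonneg a, sq_nonneg b, sq_nonneg c]
    have hb0 : b = 0 := by nlinarith [sq_nonneg a, sq_nonneg b, sq_nonneg c]
    have hc0 : c = 0 := by linarith
    exact hne ⟨by rw [t1, t2, ha0, hb0], by rw [t2, t3, hb0, hc0]⟩
  obtain ⟨s, hs⟩ : ∃ s, s = √((a^2 + b^2 + c^2) / 6) := ⟨_, rfl⟩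
  have hs0 : 0 < s := by rw [hs]; positivity
  have hs2 : s^2 = (a^2 + b^2 + c^2) / 6 := by rw [hs]; exact Real.sq_sqrt (by positivity)
  have hcc : c = -a - b := by linarith
  have hs1 : s < 1 := by
    have : s^2 < 1 := by
      rw [hs2]
      have := mul_pos ha1 hb1
      have := mul_pos hb1 hc1
      have := mul_pos ha1 hc1
      subst hcc
      nlinarith
    nlinarith
  have hq : a*b*c ≤ 2*s^3 := by
    refine le_of_sq_le_sq ?_ (by positivity)
    have e : (2*s^3)^2 = 4*((a^2 + b^2 + c^2) / 6)^3 := by rw [← hs2]; ring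
    rw [e, hcc]
    nlinarith [sq_nonneg ((a-b)*(2*a+b)*(a+2*b))]
  have eA : (1+a)*(1+b)*(1+c) = 1 - 3*s^2 + a*b*c := by rw [hs2, hcc]; ring
  have eB : (1+ν*a)*(1+ν*b)*(1+ν*c) = 1 - 3*ν^2*s^2 + ν^3*(a*b*c) := by
    rw [mul_assoc 3, mul_comm (ν^2), hs2, hcc]; ring
  have hlog : Real.log (1 - 3*s^2 + a*b*c) < 0 := by
    rw [eA] at hA
    have h4 : 0 < s^2 := by positivity
    have h5 : s^3 < s^2 := pow_lt_pow_right_of_lt_one₀ hs0 hs1 (by norm_num)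
    exact Real.log_neg hA (by linarith)
  rw [t1, t2, t3, Fnu_eq_of_mean hm0 habc hA hB, eA, eB, div_le_iff_of_neg hlog]
  exact mul_log_le_log_of_le hν1 hν2 hs0 hs1 (sq_le_of_axialQuotient_le hν1 hν2 hC)
    (hC s hs0 hs1) hq (by rwa [eA] at hA) (by rwa [eB] at hB)

theorem stmt_15 (ν : ℝ) (hν1 : -1/2 ≤ ν) (hν2 : ν < 1) :
    sSup {y : ℝ | ∃ θ₁ θ₂ θ₃ : ℝ, 0 < θ₁ ∧ 0 < θ₂ ∧ 0 < θ₃ ∧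
        ¬(θ₁ = θ₂ ∧ θ₂ = θ₃) ∧ y = Fnu ν θ₁ θ₂ θ₃}
      = sSup {y : ℝ | ∃ x : ℝ, 0 < x ∧
          y = (3 * Real.log (1 + x/3) - Real.log (1 + (1+2*ν)*x/3)
                - 2 * Real.log (1 + (1-ν)*x/3))
              / (3 * Real.log (1 + x/3) - Real.log (1 + x))} := by
  set S := {y : ℝ | ∃ θ₁ θ₂ θ₃ : ℝ, 0 < θ₁ ∧ 0 < θ₂ ∧ 0 < θ₃ ∧
        ¬(θ₁ = θ₂ ∧ θ₂ = θ₃) ∧ y = Fnu ν θ₁ θ₂ θ₃}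
  set T := {y : ℝ | ∃ x : ℝ, 0 < x ∧
          y = (3 * Real.log (1 + x/3) - Real.log (1 + (1+2*ν)*x/3)
                - 2 * Real.log (1 + (1-ν)*x/3))
              / (3 * Real.log (1 + x/3) - Real.log (1 + x))}
  have hbdd : BddAbove T := by
    refine ⟨1, ?_⟩
    rintro y ⟨x, hx, rfl⟩
    rw [quotient_eq_axialQuotient hν1 hν2 hx]
    exact axialQuotient_le_one hν1 hν2 (by positivity)
      ((div_lt_one (by positivity)).2 (by linarith))
  have hC : ∀ s, 0 < s → s < 1 → axialQuotient ν s ≤ sSup T := by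
    intro s hs0 hs1
    have h1s : 0 < 1 - s := by linarith
    have hx : 0 < 3*s/(1-s) := by positivity
    refine le_csSup hbdd ⟨3*s/(1-s), hx, ?_⟩
    rw [quotient_eq_axialQuotient hν1 hν2 hx]
    congr 1
    field_simp
    ring
  have hub : ∀ y ∈ S, y ≤ sSup T := by
    rintro y ⟨θ₁, θ₂, θ₃, h1, h2, h3, hne, rfl⟩
    exact Fnu_le_of_axialQuotient_le hν1 hν2 hC h1 h2 h3 hne
  have hTS : T ⊆ S := by
    rintro y ⟨x, hx, rfl⟩
    refine ⟨1 + x, 1, 1, by positivity, one_pos, one_pos, fun h => by linarith [h.1], ?_⟩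
    rw [quotient_eq_axialQuotient hν1 hν2 hx, Fnu_axial hν1 hν2 hx]
  have hTne : T.Nonempty := ⟨_, 1, one_pos, rfl⟩
  exact le_antisymm (csSup_le (hTne.mono hTS) hub) (csSup_le_csSup ⟨_, hub⟩ hTne hTS)
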